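/- Let S = {g_1,…,g_s} be a finite set of real polynomials in n variables. Suppose the Moment Problem is solvable for S and that the basic closed semi-algebraic set K_S has nonempty interior. Let f be a real polynomial nonnegative on K_S, and let ε > 0 be fixed. Then there exists r(f,ε,S) ∈ ℕ such that for every r ≥ r(f,ε,S), the polynomial f + ε·Θ_r lies in the preordering T_S. -/

import Mathlib

open MvPolynomial MeasureTheory

/-- `Θ_r = 1 + ∑_{j=1}^n X_j^{2r}`. -/
noncomputable def Theta (n r : ℕ) : MvPolynomial (Fin n) ℝ :=
  1 + ∑ j : Fin n, X j ^ (2 * r)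

/-- Membership in the preordering `T_S` generated by `S = {g_1,…,g_s}`: finite sums of
terms `σ_e · g_1^{e_1} ⋯ g_s^{e_s}` with `e ∈ {0,1}^s` and `σ_e` a sum of squares. -/
def InPreordering {n s : ℕ} (g : Fin s → MvPolynomial (Fin n) ℝ)
    (p : MvPolynomial (Fin n) ℝ) : Prop :=
  ∃ σ : (Fin s → Bool) → MvPolynomial (Fin n) ℝ,
    (∀ e, IsSumSq (σ e)) ∧
    p = ∑ e : Fin s → Bool, σ e * ∏ i, if e i then g i else 1

/-- The basic closed semi-algebraic set `K_S`. -/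
def KSet {n s : ℕ} (g : Fin s → MvPolynomial (Fin n) ℝ) : Set (Fin n → ℝ) :=
  {x | ∀ i, 0 ≤ eval x (g i)}

/-- The Moment Problem is solvable for `S`: every linear functional nonnegative on
`T_S` is integration with respect to some measure supported on `K_S`. -/
def MomentProblemSolvable {n s : ℕ} (g : Fin s → MvPolynomial (Fin n) ℝ) : Prop :=
  ∀ L : MvPolynomial (Fin n) ℝ →ₗ[ℝ] ℝ,
    (∀ t : MvPolynomial (Fin n) ℝ, InPreordering g t → 0 ≤ L t) →
    ∃ μ : Measure (Fin n → ℝ),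
      μ (KSet g)ᶜ = 0 ∧
      (∀ p : MvPolynomial (Fin n) ℝ, Integrable (fun x => eval x p) μ) ∧
      (∀ p : MvPolynomial (Fin n) ℝ, L p = ∫ x, eval x p ∂μ)

open Filter Topology

/-- In a real vector space with a convex cone `T`, a point `p ∉ T` bounded with respect to an
element `e ∈ T` can be weakly separated from the `e`-bounded part of `T` by a functional
normalized at `e`. -/
theorem ConvexCone.exists_linearMap_of_notMem {E : Type*} [AddCommGroup E] [Module ℝ E]
    (T : ConvexCone ℝ E) (h0 : (0 : E) ∈ T) {e p : E} (he : e ∈ T) (hne : -e ∉ T) (hp : p ∉ T)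
    (hpe : ∃ c : ℝ, c • e + p ∈ T ∧ c • e - p ∈ T) :
    ∃ L : E →ₗ[ℝ] ℝ, L e = 1 ∧ L p ≤ 0 ∧
      ∀ v ∈ T, (∃ c : ℝ, c • e + v ∈ T ∧ c • e - v ∈ T) → 0 ≤ L v := by
  have hsmul : ∀ {c : ℝ} {v : E}, 0 ≤ c → v ∈ T → c • v ∈ T := by
    intro c v hc hv
    rcases hc.eq_or_lt with rfl | hc
    · simpa using h0
    · exact T.smul_mem hc hv
  let V : Submodule ℝ E :=
    { carrier := {v | ∃ c : ℝ, c • e + v ∈ T ∧ c • e - v ∈ T}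
      zero_mem' := ⟨0, by simpa using h0, by simpa using h0⟩
      add_mem' := by
        rintro a b ⟨c, h1, h2⟩ ⟨d, h3, h4⟩
        refine ⟨c + d, ?_, ?_⟩
        · convert T.add_mem h1 h3 using 1; module
        · convert T.add_mem h2 h4 using 1; module
      smul_mem' := by
        rintro a b ⟨c, h1, h2⟩
        rcases le_total 0 a with ha | ha
        · refine ⟨a * c, ?_, ?_⟩
          · convert hsmul ha h1 using 1; module
          · convert hsmul ha h2 using 1; module
        · refine ⟨-a * c, ?_, ?_⟩
          · convert hsmul (neg_nonneg.2 ha) h2 using 1; module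
          · convert hsmul (neg_nonneg.2 ha) h1 using 1; module }
  have heV : e ∈ V := ⟨1, by simpa using T.add_mem he he, by simpa using h0⟩
  let s : ConvexCone ℝ V :=
    { carrier := {v | ∃ c : ℝ, 0 ≤ c ∧ (v : E) + c • p ∈ T}
      smul_mem' := by
        rintro a ha v ⟨c, hc, h⟩
        refine ⟨a * c, by positivity, ?_⟩
        convert T.smul_mem ha h using 1
        push_cast
        module
      add_mem' := by
        rintro v ⟨c, hc, h⟩ w ⟨d, hd, h'⟩
        refine ⟨c + d, by positivity, ?_⟩
        convert T.add_mem h h' using 1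
        push_cast
        module }
  have he0 : (⟨e, heV⟩ : V) ≠ 0 := by
    intro h
    have : e = 0 := congrArg Subtype.val h
    exact hne (by simpa [this] using h0)
  let φ : V →ₗ.[ℝ] ℝ := LinearPMap.mkSpanSingleton (⟨e, heV⟩ : V) (1 : ℝ) he0
  have hmk : ∀ a : ℝ, ∃ h : a • (⟨e, heV⟩ : V) ∈ φ.domain, φ ⟨_, h⟩ = a := fun a =>
    ⟨Submodule.smul_mem _ _ (Submodule.mem_span_singleton_self _),
      (LinearPMap.mkSpanSingleton'_apply _ _ _ _ _).trans (mul_one a)⟩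
  obtain ⟨G, hG, hGs⟩ := riesz_extension (s.toPointedCone ⟨0, le_rfl, by simpa using h0⟩) φ (by
      rintro ⟨x, hx⟩ hxs
      obtain ⟨a, rfl⟩ := Submodule.mem_span_singleton.1 hx
      obtain ⟨h, h'⟩ := hmk a
      rw [h']
      by_contra! ha
      obtain ⟨c, hc, hT⟩ := hxs
      change a • e + c • p ∈ T at hT
      rcases hc.eq_or_lt with rfl | hc
      · apply hne
        convert T.smul_mem (inv_pos.2 (neg_pos.2 ha)) hT using 1
        rw [zero_smul, add_zero, smul_smul, inv_neg, neg_mul, inv_mul_cancel₀ ha.ne]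
        simp
      · apply hp
        convert T.smul_mem (inv_pos.2 hc) (T.add_mem hT (T.smul_mem (neg_pos.2 ha) he)) using 1
        rw [add_right_comm, ← add_smul, add_neg_cancel, zero_smul, zero_add, smul_smul,
          inv_mul_cancel₀ hc.ne', one_smul]) (by
      rintro ⟨y, c, h1, h2⟩
      exact ⟨⟨_, (hmk c).1⟩, 0, le_rfl, by simpa using h1⟩)
  obtain ⟨L, hL⟩ := G.exists_extend
  have hLV : ∀ v (hv : v ∈ V), L v = G ⟨v, hv⟩ := fun v hv => by rw [← hL]; rfl
  refine ⟨L, ?_, ?_, ?_⟩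
  · obtain ⟨h, h'⟩ := hmk 1
    rw [hLV e heV, ← h', ← hG]
    simp
  · have : 0 ≤ G (-⟨p, hpe⟩) := hGs _ ⟨1, zero_le_one, by simpa using h0⟩
    rw [hLV p hpe]
    simpa using this
  · intro v hv hve
    rw [hLV v hve]
    exact hGs _ ⟨0, le_rfl, by simpa using hv⟩

theorem IsSumSq.of_eq {R : Type*} [CommRing R] {a b : R} (ha : IsSumSq a) (h : b = a) :
    IsSumSq b := h ▸ ha

theorem isSumSq_pow_two_mul {R : Type*} [CommRing R] (x : R) (k : ℕ) :
    IsSumSq (x ^ (2 * k)) := by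
  rw [mul_comm, pow_mul, pow_two]
  exact IsSumSq.mul_self _

theorem isSumSq_one_add_pow_sub_pow {R : Type*} [CommRing R] (x : R) {k r : ℕ} (hk : k ≤ r) :
    IsSumSq (1 + x ^ (2 * r) - x ^ (2 * k)) := by
  obtain ⟨m, rfl⟩ := Nat.exists_eq_add_of_le hk
  have hgeom : ∀ a : ℕ, IsSumSq (∑ i ∈ Finset.range a, (x ^ 2) ^ i) := fun a =>
    IsSumSq.sum fun i _ => by rw [← pow_mul]; exact isSumSq_pow_two_mul x i
  have h : 1 + x ^ (2 * (k + m)) - x ^ (2 * k) =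
      (1 - x ^ 2) * (1 - x ^ 2) * ((∑ i ∈ Finset.range k, (x ^ 2) ^ i) *
        ∑ i ∈ Finset.range m, (x ^ 2) ^ i) + x ^ (2 * m) := by
    have h1 := mul_neg_geom_sum (x ^ 2) k
    have h2 := mul_neg_geom_sum (x ^ 2) m
    rw [← pow_mul] at h1 h2
    rw [mul_mul_mul_comm, h1, h2]
    ring
  rw [h]
  exact ((IsSumSq.mul_self _).mul ((hgeom k).mul (hgeom m))).add (isSumSq_pow_two_mul x m)

theorem isSumSq_C {n : ℕ} {c : ℝ} (hc : 0 ≤ c) : IsSumSq (C c : MvPolynomial (Fin n) ℝ) := by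
  rw [← Real.mul_self_sqrt hc, C_mul]
  exact IsSumSq.mul_self _

/-- `p` is bounded, in the order given by sums of squares, by a multiple of `Θ_r` that does not
depend on `r` for large `r`. -/
def ThetaBounded {n : ℕ} (p : MvPolynomial (Fin n) ℝ) : Prop :=
  ∃ c : ℝ, 0 ≤ c ∧ ∃ r0 : ℕ, ∀ r, r0 ≤ r →
    IsSumSq (C c * Theta n r + p) ∧ IsSumSq (C c * Theta n r - p)

namespace ThetaBounded

variable {n : ℕ} {p q : MvPolynomial (Fin n) ℝ}

theorem add (hp : ThetaBounded p) (hq : ThetaBounded q) : ThetaBounded (p + q) := by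
  obtain ⟨c, hc, r0, h⟩ := hp
  obtain ⟨d, hd, r1, h'⟩ := hq
  refine ⟨c + d, by positivity, max r0 r1, fun r hr => ⟨?_, ?_⟩⟩
  · refine IsSumSq.of_eq ((h r (le_of_max_le_left hr)).1.add (h' r (le_of_max_le_right hr)).1) ?_
    rw [C_add]; ring
  · refine IsSumSq.of_eq ((h r (le_of_max_le_left hr)).2.add (h' r (le_of_max_le_right hr)).2) ?_
    rw [C_add]; ring

theorem C_mul (hp : ThetaBounded p) (a : ℝ) : ThetaBounded (C a * p) := by
  obtain ⟨c, hc, r0, h⟩ := hp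
  rcases le_total 0 a with ha | ha
  · refine ⟨a * c, by positivity, r0, fun r hr => ⟨?_, ?_⟩⟩
    · refine IsSumSq.of_eq ((isSumSq_C ha).mul (h r hr).1) ?_
      rw [MvPolynomial.C_mul]; ring
    · refine IsSumSq.of_eq ((isSumSq_C ha).mul (h r hr).2) ?_
      rw [MvPolynomial.C_mul]; ring
  · refine ⟨-a * c, mul_nonneg (neg_nonneg.2 ha) hc, r0, fun r hr => ⟨?_, ?_⟩⟩
    · refine IsSumSq.of_eq ((isSumSq_C (neg_nonneg.2 ha)).mul (h r hr).2) ?_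
      rw [MvPolynomial.C_mul, C_neg]; ring
    · refine IsSumSq.of_eq ((isSumSq_C (neg_nonneg.2 ha)).mul (h r hr).1) ?_
      rw [MvPolynomial.C_mul, C_neg]; ring

theorem mul_of_sq (hp : ThetaBounded (p ^ 2)) (hq : ThetaBounded (q ^ 2)) :
    ThetaBounded (p * q) := by
  obtain ⟨c, hc, r0, h⟩ := (hp.add hq).C_mul (1 / 2)
  have h2 : (C (1 / 2) : MvPolynomial (Fin n) ℝ) * 2 = 1 := by
    rw [← map_ofNat C 2, ← MvPolynomial.C_mul]
    norm_num
  refine ⟨c, hc, r0, fun r hr => ⟨?_, ?_⟩⟩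
  · refine IsSumSq.of_eq ((h r hr).2.add ((isSumSq_C (by norm_num : (0 : ℝ) ≤ 1 / 2)).mul
      (IsSumSq.mul_self (p + q)))) ?_
    linear_combination (-p * q) * h2
  · refine IsSumSq.of_eq ((h r hr).2.add ((isSumSq_C (by norm_num : (0 : ℝ) ≤ 1 / 2)).mul
      (IsSumSq.mul_self (p - q)))) ?_
    linear_combination (p * q) * h2

theorem one : ThetaBounded (1 : MvPolynomial (Fin n) ℝ) := by
  have hs : ∀ r, IsSumSq (∑ j : Fin n, (X j : MvPolynomial (Fin n) ℝ) ^ (2 * r)) := fun r =>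
    IsSumSq.sum fun j _ => isSumSq_pow_two_mul _ _
  refine ⟨1, zero_le_one, 0, fun r _ => ⟨?_, ?_⟩⟩
  · refine IsSumSq.of_eq (((IsSumSq.mul_self 1).add (IsSumSq.mul_self 1)).add (hs r)) ?_
    rw [Theta, C_1]; ring
  · refine IsSumSq.of_eq (hs r) ?_
    rw [Theta, C_1]; ring

theorem X_pow_two_mul (j : Fin n) (k : ℕ) :
    ThetaBounded ((X j : MvPolynomial (Fin n) ℝ) ^ (2 * k)) := by
  have hΘ : ∀ r, Theta n r = 1 + X j ^ (2 * r) +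
      ∑ i ∈ Finset.univ.erase j, (X i : MvPolynomial (Fin n) ℝ) ^ (2 * r) := fun r => by
    rw [Theta, add_assoc, Finset.add_sum_erase _
      (fun i => (X i : MvPolynomial (Fin n) ℝ) ^ (2 * r)) (Finset.mem_univ j)]
  have hs : ∀ r, IsSumSq (∑ i ∈ Finset.univ.erase j,
      (X i : MvPolynomial (Fin n) ℝ) ^ (2 * r)) := fun r =>
    IsSumSq.sum fun j _ => isSumSq_pow_two_mul _ _
  refine ⟨1, zero_le_one, k, fun r hr => ⟨?_, ?_⟩⟩
  · refine IsSumSq.of_eq ((((IsSumSq.mul_self 1).add (isSumSq_pow_two_mul (X j) r)).add (hs r)).add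
      (isSumSq_pow_two_mul (X j) k)) ?_
    rw [hΘ, C_1]; ring
  · refine IsSumSq.of_eq ((isSumSq_one_add_pow_sub_pow (X j) hr).add (hs r)) ?_
    rw [hΘ, C_1]; ring

theorem X_pow (j : Fin n) (k : ℕ) : ThetaBounded ((X j : MvPolynomial (Fin n) ℝ) ^ k) := by
  rw [← mul_one (X j ^ k)]
  refine mul_of_sq ?_ (by simpa using one)
  rw [← pow_mul, mul_comm]
  exact X_pow_two_mul j k

/-- Polynomials all of whose powers are bounded. -/
def submonoid (n : ℕ) : Submonoid (MvPolynomial (Fin n) ℝ) where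
  carrier := {p | ∀ k : ℕ, ThetaBounded (p ^ k)}
  one_mem' := fun k => by simpa using one
  mul_mem' := fun {p q} hp hq k => by
    rw [mul_pow]
    exact mul_of_sq (by rw [← pow_mul]; exact hp _) (by rw [← pow_mul]; exact hq _)

theorem of_mvPolynomial (p : MvPolynomial (Fin n) ℝ) : ThetaBounded p := by
  induction p using MvPolynomial.induction_on' with
  | monomial u a =>
    rw [monomial_eq]
    refine C_mul ?_ a
    have h : (u.prod fun i k => (X i : MvPolynomial (Fin n) ℝ) ^ k) ∈ submonoid n :=
      Submonoid.prod_mem _ fun i _ => (submonoid n).pow_mem (show X i ∈ submonoid n from X_pow i) _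
    simpa using h 1
  | add p q hp hq => exact hp.add hq

end ThetaBounded

namespace InPreordering

variable {n s : ℕ} {g : Fin s → MvPolynomial (Fin n) ℝ} {p q : MvPolynomial (Fin n) ℝ}

theorem add (hp : InPreordering g p) (hq : InPreordering g q) : InPreordering g (p + q) := by
  obtain ⟨σ, hσ, rfl⟩ := hp
  obtain ⟨τ, hτ, rfl⟩ := hq
  exact ⟨fun e => σ e + τ e, fun e => (hσ e).add (hτ e), by
    simp only [add_mul, Finset.sum_add_distrib]⟩

theorem sumSq_mul (hq : IsSumSq q) (hp : InPreordering g p) : InPreordering g (q * p) := by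
  obtain ⟨σ, hσ, rfl⟩ := hp
  exact ⟨fun e => q * σ e, fun e => hq.mul (hσ e), by simp only [Finset.mul_sum, mul_assoc]⟩

theorem of_isSumSq (hp : IsSumSq p) : InPreordering g p := by
  refine ⟨fun e => if e = fun _ => false then p else 0, fun e => ?_, ?_⟩
  · dsimp only
    split_ifs
    · exact hp
    · exact IsSumSq.zero
  · rw [Finset.sum_eq_single (fun _ => false)]
    · simp
    · intro e _ he
      simp [he]
    · simp

theorem of_neg_one (h : InPreordering g (-1)) (p : MvPolynomial (Fin n) ℝ) :
    InPreordering g p := by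
  have h2 : (C (1 / 2) : MvPolynomial (Fin n) ℝ) * 2 = 1 := by
    rw [← map_ofNat C 2, ← MvPolynomial.C_mul]
    norm_num
  convert (of_isSumSq (IsSumSq.mul_self (C (1 / 2) * (p + 1)))).add
    (sumSq_mul (IsSumSq.mul_self (C (1 / 2) * (p - 1))) h) using 1
  linear_combination (-p * (1 + C (1 / 2) * 2)) * h2

/-- The preordering as a convex cone. -/
def cone (g : Fin s → MvPolynomial (Fin n) ℝ) : ConvexCone ℝ (MvPolynomial (Fin n) ℝ) where
  carrier := {p | InPreordering g p}
  smul_mem' := fun {c} hc p hp => by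
    change InPreordering g (c • p)
    rw [smul_eq_C_mul]
    exact sumSq_mul (isSumSq_C hc.le) hp
  add_mem' := fun {_} hp {_} hq => hp.add hq

end InPreordering

theorem isSumSq_Theta (n r : ℕ) : IsSumSq (Theta n r) := by
  refine IsSumSq.of_eq ((IsSumSq.mul_self (1 : MvPolynomial (Fin n) ℝ)).add
    (IsSumSq.sum fun j (_ : j ∈ Finset.univ) => isSumSq_pow_two_mul (X j) r)) ?_
  rw [mul_one, Theta]

theorem InPreordering.of_neg_Theta {n s r : ℕ} {g : Fin s → MvPolynomial (Fin n) ℝ}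
    (h : InPreordering g (-Theta n r)) (p : MvPolynomial (Fin n) ℝ) : InPreordering g p := by
  refine of_neg_one ?_ p
  convert h.add (of_isSumSq (IsSumSq.sum fun j (_ : j ∈ Finset.univ) =>
    isSumSq_pow_two_mul (X j) r)) using 1
  rw [Theta]; ring

/-- Linear functionals that are eventually bounded and eventually nonnegative on a set, pointwise
along an ultrafilter, have a pointwise limit. -/
theorem exists_linearMap_tendsto {ι E : Type*} [AddCommGroup E] [Module ℝ E] (U : Ultrafilter ι)
    (L : ι → E →ₗ[ℝ] ℝ) (h : ∀ q, ∃ c : ℝ, ∀ᶠ r in U, |L r q| ≤ c) :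
    ∃ M : E →ₗ[ℝ] ℝ, ∀ q, Tendsto (fun r => L r q) U (𝓝 (M q)) := by
  have hlim : ∀ q, ∃ l : ℝ, Tendsto (fun r => L r q) U (𝓝 l) := fun q => by
    obtain ⟨c, hc⟩ := h q
    obtain ⟨l, -, hl⟩ := (isCompact_Icc (a := -c) (b := c)).ultrafilter_le_nhds
      (U.map fun r => L r q) (by
        rw [le_principal_iff]
        exact hc.mono fun r hr => abs_le.1 hr)
    exact ⟨l, hl⟩
  choose M hM using hlim
  exact ⟨{ toFun := M
           map_add' := fun p q => tendsto_nhds_unique (hM _) (by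
             simpa using (hM p).add (hM q))
           map_smul' := fun a q => tendsto_nhds_unique (hM _) (by
             simpa using (hM q).const_mul a) }, hM⟩

/-- If the Moment Problem is solvable for `S` and `K_S` has nonempty interior, then for
any `f` nonnegative on `K_S` and `ε > 0`, the polynomial `f + ε Θ_r` lies in `T_S` for
all sufficiently large `r`. -/
theorem stmt_7 (n s : ℕ) (g : Fin s → MvPolynomial (Fin n) ℝ)
    (hmp : MomentProblemSolvable g)
    (hint : (interior (KSet g)).Nonempty)
    (f : MvPolynomial (Fin n) ℝ)
    (hf : ∀ x ∈ KSet g, 0 ≤ eval x f)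
    (ε : ℝ) (hε : 0 < ε) :
    ∃ r0 : ℕ, ∀ r : ℕ, r0 ≤ r → InPreordering g (f + C ε * Theta n r) := by
  by_contra! hbad
  have hfreq : ∃ᶠ r in atTop, ¬ InPreordering g (f + C ε * Theta n r) :=
    frequently_atTop.2 hbad
  set F : Filter ℕ := atTop ⊓ 𝓟 {r | ¬ InPreordering g (f + C ε * Theta n r)}
  have : F.NeBot := frequently_mem_iff_neBot.1 hfreq
  set U : Ultrafilter ℕ := Ultrafilter.of F
  have hU : (U : Filter ℕ) ≤ F := Ultrafilter.of_le F
  have hUtop : (U : Filter ℕ) ≤ atTop := hU.trans inf_le_left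
  have hUbad : ∀ᶠ r in (U : Filter ℕ), ¬ InPreordering g (f + C ε * Theta n r) :=
    (hU.trans inf_le_right) (mem_principal_self _)
  have hbdd : ∀ q : MvPolynomial (Fin n) ℝ, ∃ c : ℝ, ∀ᶠ r in (U : Filter ℕ),
      c • Theta n r + q ∈ InPreordering.cone g ∧ c • Theta n r - q ∈ InPreordering.cone g := by
    intro q
    obtain ⟨c, -, r0, h⟩ := ThetaBounded.of_mvPolynomial q
    refine ⟨c, hUtop ((eventually_ge_atTop r0).mono fun r hr => ?_)⟩
    rw [smul_eq_C_mul]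
    exact ⟨InPreordering.of_isSumSq (h r hr).1, InPreordering.of_isSumSq (h r hr).2⟩
  have hsep : ∀ᶠ r in (U : Filter ℕ), ∃ L : MvPolynomial (Fin n) ℝ →ₗ[ℝ] ℝ,
      L (Theta n r) = 1 ∧ L f ≤ -ε ∧ ∀ v ∈ InPreordering.cone g,
        (∃ c : ℝ, c • Theta n r + v ∈ InPreordering.cone g ∧
          c • Theta n r - v ∈ InPreordering.cone g) → 0 ≤ L v := by
    obtain ⟨c, hc⟩ := hbdd f
    filter_upwards [hUbad, hc] with r hr hcr
    obtain ⟨L, h1, h2, h3⟩ := (InPreordering.cone g).exists_linearMap_of_notMem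
      (InPreordering.of_isSumSq IsSumSq.zero) (InPreordering.of_isSumSq (isSumSq_Theta n r))
      (fun h => hr (InPreordering.of_neg_Theta h _)) hr
      ⟨c + ε, by
        convert (InPreordering.cone g).add_mem hcr.1 ((InPreordering.cone g).smul_mem
          (by positivity : 0 < 2 * ε) (InPreordering.of_isSumSq (isSumSq_Theta n r))) using 1
        rw [← smul_eq_C_mul]
        module, by
        convert hcr.2 using 1
        rw [← smul_eq_C_mul]
        module⟩
    refine ⟨L, h1, ?_, h3⟩
    rw [← smul_eq_C_mul, map_add, map_smul, h1, smul_eq_mul] at h2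
    linarith
  obtain ⟨L, hL⟩ := hsep.choice
  obtain ⟨M, hM⟩ := exists_linearMap_tendsto U L fun q => by
    obtain ⟨c, hc⟩ := hbdd q
    refine ⟨c, ?_⟩
    filter_upwards [hL, hc] with r ⟨h1, _, h3⟩ ⟨hc1, hc2⟩
    have hpos : ∀ v, c • Theta n r + v ∈ InPreordering.cone g →
        c • Theta n r - v ∈ InPreordering.cone g → 0 ≤ c + L r v := by
      intro v hv1 hv2
      have := h3 (c • Theta n r + v) hv1 ⟨2 * c, by
        convert (InPreordering.cone g).add_mem ((InPreordering.cone g).add_mem hv1 hv1) hv2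
          using 1
        module, by
        convert hv2 using 1
        module⟩
      simpa [h1] using this
    rw [abs_le]
    have h4 := hpos q hc1 hc2
    have h5 := hpos (-q) (by rwa [← sub_eq_add_neg]) (by rwa [sub_neg_eq_add])
    rw [map_neg] at h5
    constructor <;> linarith
  obtain ⟨μ, hμ, -, hMμ⟩ := hmp M fun t ht => by
    refine ge_of_tendsto (hM t) ?_
    obtain ⟨c, hc⟩ := hbdd t
    filter_upwards [hL, hc] with r hr hcr
    exact hr.2.2 t ht ⟨c, hcr⟩
  have hneg : M f ≤ -ε := le_of_tendsto (hM f) (hL.mono fun r hr => hr.2.1)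
  have hnonneg : 0 ≤ M f := by
    rw [hMμ]
    refine integral_nonneg_of_ae ?_
    have hK : ∀ᵐ x ∂μ, x ∈ KSet g := hμ
    filter_upwards [hK] with x hx using hf x hx
  linarith
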